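/- Tensorization of Young measures: Let (Ω,μ) be a finite measure space and let u_n : Ω → ℝ^k be a sequence of measurable maps generating the Young measure ν, in the sense that ν : Ω → P(ℝ^k) is weak-*-measurable and for every f ∈ C₀(ℝ^k) and every g ∈ L¹(Ω,μ), ∫_Ω g(x) f(u_n(x)) dμ(x) → ∫_Ω g(x) (∫_{ℝ^k} f dν_x) dμ(x). Then the sequence of maps (x,y) ↦ (u_n(x), u_n(y)) generates the tensorized Young measure ν²_{x,y} = ν_x ⊗ ν_y: for every F ∈ C₀(ℝ^k × ℝ^k) and every G ∈ L¹(Ω×Ω, μ⊗μ), ∫∫_{Ω×Ω} G(x,y) F(u_n(x), u_n(y)) dμ(x)dμ(y) → ∫∫_{Ω×Ω} G(x,y) (∫∫ F d(ν_x ⊗ ν_y)) dμ(x)dμ(y). -/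

import Mathlib

open MeasureTheory Real Filter Topology

noncomputable section

section ContinuousMap

variable {X Y : Type*} [TopologicalSpace X] [TopologicalSpace Y]

theorem ContinuousMap.exists_apply_ne_of_ne [NormalSpace X] [T1Space X] {x y : X}
    (h : x ≠ y) : ∃ f : C(X, ℝ), f x ≠ f y := by
  obtain ⟨f, hf0, hf1, -⟩ := exists_continuous_zero_one_of_isClosed
    (isClosed_singleton (x := x)) (isClosed_singleton (x := y)) (by simpa using h)
  refine ⟨f, ?_⟩
  rw [hf0 rfl, hf1 rfl]
  simp

/-- By Stone–Weierstrass, a closed property of continuous functions on a product of two compact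
Hausdorff spaces that is stable under linear combinations holds as soon as it holds for products
of functions of one variable. -/
theorem ContinuousMap.prod_induction [CompactSpace X] [CompactSpace Y] [T2Space X] [T2Space Y]
    {P : C(X × Y, ℝ) → Prop}
    (mul : ∀ (f : C(X, ℝ)) (g : C(Y, ℝ)), P (f.comp .fst * g.comp .snd))
    (add : ∀ H₁ H₂, P H₁ → P H₂ → P (H₁ + H₂))
    (smul : ∀ (c : ℝ) H, P H → P (c • H))
    (closed : IsClosed {H | P H}) (H : C(X × Y, ℝ)) : P H := by
  let S : Submonoid C(X × Y, ℝ) :=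
    { carrier := {H | ∃ (f : C(X, ℝ)) (g : C(Y, ℝ)), H = f.comp .fst * g.comp .snd}
      one_mem' := ⟨1, 1, by ext; simp⟩
      mul_mem' := by
        rintro _ _ ⟨f, g, rfl⟩ ⟨f', g', rfl⟩
        exact ⟨f * f', g * g', by ext; simp [mul_mul_mul_comm]⟩ }
  let A : Subalgebra ℝ C(X × Y, ℝ) := Algebra.adjoin ℝ (S : Set C(X × Y, ℝ))
  have hsep : A.SeparatesPoints := by
    rintro ⟨x, y⟩ ⟨x', y'⟩ hne
    by_cases hx : x = x'
    · have hy : y ≠ y' := fun hy => hne (by rw [hx, hy])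
      obtain ⟨g, hg⟩ := exists_apply_ne_of_ne hy
      exact ⟨_, ⟨_, Algebra.subset_adjoin ⟨1, g, rfl⟩, rfl⟩, by simpa using hg⟩
    · obtain ⟨f, hf⟩ := exists_apply_ne_of_ne hx
      exact ⟨_, ⟨_, Algebra.subset_adjoin ⟨f, 1, rfl⟩, rfl⟩, by simpa using hf⟩
  have hA : (A : Set C(X × Y, ℝ)) ⊆ {H | P H} := by
    intro H hH
    have hH' : H ∈ Submodule.span ℝ (S : Set C(X × Y, ℝ)) := by
      have : H ∈ Subalgebra.toSubmodule A := hH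
      rwa [Algebra.adjoin_eq_span, Submonoid.closure_eq] at this
    induction hH' using Submodule.span_induction with
    | mem H h =>
      obtain ⟨f, g, rfl⟩ := h
      exact mul f g
    | zero => simpa using smul 0 _ (mul 0 0)
    | add H₁ H₂ h₁ h₂ ih₁ ih₂ =>
      have mem {H} (h : H ∈ Submodule.span ℝ (S : Set C(X × Y, ℝ))) : H ∈ A :=
        Algebra.span_le_adjoin ℝ _ h
      exact add _ _ (ih₁ (mem h₁)) (ih₂ (mem h₂))
    | smul c H h ih => exact smul c H (ih (Algebra.span_le_adjoin ℝ _ h))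
  have hH : H ∈ A.topologicalClosure := by
    rw [subalgebra_topologicalClosure_eq_top_of_separatesPoints A hsep]
    trivial
  exact closure_minimal hA closed hH

/-- Extension by zero along an open embedding into a Hausdorff space preserves continuity of
functions vanishing at infinity. -/
theorem Topology.IsOpenEmbedding.continuous_extend_zero [T2Space Y] {j : X → Y}
    (hj : IsOpenEmbedding j) (F : ZeroAtInftyContinuousMap X ℝ) :
    Continuous (Function.extend j F 0) := by
  rw [continuous_iff_continuousAt]
  intro z
  by_cases hz : z ∈ Set.range j
  · obtain ⟨x, rfl⟩ := hz
    rw [← hj.continuousAt_iff, Function.extend_comp hj.injective]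
    exact F.continuous.continuousAt
  · rw [ContinuousAt, Function.extend_apply' _ _ _ (by simpa using hz), Metric.tendsto_nhds]
    intro ε hε
    have hF := Metric.tendsto_nhds.1 (zero_at_infty F) ε hε
    obtain ⟨K, hK, hKF⟩ := mem_cocompact.1 hF
    filter_upwards [(hK.image hj.continuous).isClosed.isOpen_compl.mem_nhds
      (show z ∈ (j '' K)ᶜ from fun ⟨x, _, hx⟩ => hz ⟨x, hx⟩)] with w hw
    by_cases hwj : w ∈ Set.range j
    · obtain ⟨x, rfl⟩ := hwj
      rw [hj.injective.extend_apply]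
      exact hKF fun hx => hw ⟨x, hx, rfl⟩
    · rw [Function.extend_apply' _ _ _ (by simpa using hwj)]
      simpa using hε

/-- The restriction to `X` of a continuous function on the one-point compactification, normalized
to vanish at infinity. -/
def OnePoint.toZeroAtInfty [T2Space X] (f : C(OnePoint X, ℝ)) : ZeroAtInftyContinuousMap X ℝ where
  toFun x := f x - f infty
  continuous_toFun := (f.continuous.comp continuous_coe).sub continuous_const
  zero_at_infty' := by
    have h := (f.continuous.tendsto infty).comp tendsto_coe_infty
    rw [coclosedCompact_eq_cocompact] at h
    simpa using h.sub_const (f infty)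

end ContinuousMap

section WeakStar

variable {X Y : Type*} [MeasurableSpace X] [MeasurableSpace Y]

theorem MeasureTheory.integral_indicator_const_mul {μ : Measure X} {s : Set X}
    (hs : MeasurableSet s) (c : ℝ) (f : X → ℝ) :
    ∫ x, s.indicator (fun _ => c) x * f x ∂μ = c * ∫ x in s, f x ∂μ := by
  rw [← integral_const_mul, ← integral_indicator hs]
  congr 1 with x
  by_cases hx : x ∈ s <;> simp [hx]

theorem MeasureTheory.lipschitzWith_integral_mul_left {μ : Measure X} {h : X → ℝ} {C : NNReal}
    (hm : Measurable h) (hC : ∀ x, ‖h x‖ ≤ C) :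
    LipschitzWith C fun f : X →₁[μ] ℝ => ∫ x, f x * h x ∂μ := by
  refine LipschitzWith.of_dist_le_mul fun f g => ?_
  have hint (f : X →₁[μ] ℝ) : Integrable (fun x => f x * h x) μ :=
    (L1.integrable_coeFn f).mul_bdd hm.aestronglyMeasurable (ae_of_all _ hC)
  rw [dist_eq_norm, dist_eq_norm, ← integral_sub (hint f) (hint g), L1.norm_eq_integral_norm,
    ← integral_const_mul]
  refine norm_integral_le_of_norm_le ((L1.integrable_coeFn _).norm.const_mul _) ?_
  filter_upwards [Lp.coeFn_sub f g] with x hx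
  rw [← sub_mul, norm_mul, hx, mul_comm, Pi.sub_apply]
  gcongr
  exact hC x

theorem MeasureTheory.lipschitzWith_integral_mul_of_forall {B : Type*}
    [SeminormedAddCommGroup B] {μ : Measure X} {g : X → ℝ} (hg : Integrable g μ)
    {L : B → X → ℝ} (hm : ∀ H, Measurable (L H)) (hb : ∀ H x, ‖L H x‖ ≤ ‖H‖)
    (hL : ∀ x, LipschitzWith 1 fun H => L H x) :
    LipschitzWith (∫ x, ‖g x‖ ∂μ).toNNReal fun H => ∫ x, g x * L H x ∂μ := by
  have hint (H : B) : Integrable (fun x => g x * L H x) μ :=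
    hg.mul_bdd (hm H).aestronglyMeasurable (ae_of_all _ (hb H))
  refine LipschitzWith.of_dist_le_mul fun H₁ H₂ => ?_
  rw [Real.coe_toNNReal _ (integral_nonneg fun _ => norm_nonneg _), dist_eq_norm,
    ← integral_sub (hint _) (hint _), ← integral_mul_const]
  refine norm_integral_le_of_norm_le (hg.norm.mul_const _) (ae_of_all _ fun x => ?_)
  rw [← mul_sub, norm_mul, ← dist_eq_norm]
  gcongr
  simpa using (hL x).dist_le_mul H₁ H₂

/-- For a bounded sequence in `L^∞` of a finite measure, weak-* convergence can be tested on the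
indicators of a generating π-system containing the whole space. -/
theorem MeasureTheory.tendsto_integral_mul_of_piSystem {μ : Measure X} [IsFiniteMeasure μ]
    {S : Set (Set X)} (hS : ‹MeasurableSpace X› = MeasurableSpace.generateFrom S)
    (hpi : IsPiSystem S) (huniv : Set.univ ∈ S)
    {h : ℕ → X → ℝ} {h' : X → ℝ} {C : NNReal}
    (hm : ∀ n, Measurable (h n)) (hm' : Measurable h')
    (hC : ∀ n x, ‖h n x‖ ≤ C) (hC' : ∀ x, ‖h' x‖ ≤ C)
    (hlim : ∀ s ∈ S, Tendsto (fun n => ∫ x in s, h n x ∂μ) atTop (𝓝 (∫ x in s, h' x ∂μ)))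
    {g : X → ℝ} (hg : Integrable g μ) :
    Tendsto (fun n => ∫ x, g x * h n x ∂μ) atTop (𝓝 (∫ x, g x * h' x ∂μ)) := by
  have hi (n : ℕ) : Integrable (h n) μ :=
    .of_bound (hm n).aestronglyMeasurable C (ae_of_all _ (hC n))
  have hi' : Integrable h' μ := .of_bound hm'.aestronglyMeasurable C (ae_of_all _ hC')
  have hmul {f : X → ℝ} (hf : Integrable f μ) (n : ℕ) : Integrable (fun x => f x * h n x) μ :=
    hf.mul_bdd (hm n).aestronglyMeasurable (ae_of_all _ (hC n))
  have hmul' {f : X → ℝ} (hf : Integrable f μ) : Integrable (fun x => f x * h' x) μ :=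
    hf.mul_bdd hm'.aestronglyMeasurable (ae_of_all _ hC')
  have hset : ∀ s, MeasurableSet s →
      Tendsto (fun n => ∫ x in s, h n x ∂μ) atTop (𝓝 (∫ x in s, h' x ∂μ)) := by
    intro s hs
    induction s, hs using MeasurableSpace.induction_on_inter hS hpi with
    | empty => simp
    | basic s hs => exact hlim s hs
    | compl s hs ih =>
      have key {f : X → ℝ} (hf : Integrable f μ) :
          ∫ x in sᶜ, f x ∂μ = ∫ x in Set.univ, f x ∂μ - ∫ x in s, f x ∂μ := by
        rw [setIntegral_univ, ← integral_add_compl hs hf, add_sub_cancel_left]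
      simp_rw [key hi', key (hi _)]
      exact (hlim _ huniv).sub ih
    | iUnion s hd hs ih =>
      simp_rw [integral_iUnion hs hd (hi _).integrableOn, integral_iUnion hs hd hi'.integrableOn]
      refine tendsto_tsum_of_dominated_convergence (bound := fun i => C * μ.real (s i))
        ((summable_measure_toReal hs hd).mul_left _) ih (Eventually.of_forall fun n i => ?_)
      exact norm_setIntegral_le_of_norm_le_const (measure_lt_top _ _) fun x _ => hC n x
  refine Integrable.induction (P := fun g => Tendsto (fun n => ∫ x, g x * h n x ∂μ) atTop
    (𝓝 (∫ x, g x * h' x ∂μ))) (fun c s hs _ => ?_) (fun f g _ hf hg ihf ihg => ?_) ?_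
    (fun f g hfg hf ih => ?_) hg
  · simp_rw [integral_indicator_const_mul hs]
    exact (hset s hs).const_mul c
  · simp_rw [Pi.add_apply, add_mul, integral_add (hmul hf _) (hmul hg _),
      integral_add (hmul' hf) (hmul' hg)]
    exact ihf.add ihg
  · exact (LipschitzWith.uniformEquicontinuous _ C fun n =>
      lipschitzWith_integral_mul_left (hm n) (hC n)).equicontinuous.isClosed_setOfPred_tendsto
        (lipschitzWith_integral_mul_left hm' hC').continuous
  · have key (k : X → ℝ) : ∫ x, g x * k x ∂μ = ∫ x, f x * k x ∂μ :=
      integral_congr_ae (by filter_upwards [hfg] with x hx; rw [hx])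
    simpa only [key] using ih

/-- The tensor product of two bounded weak-* convergent sequences converges weak-*. -/
theorem MeasureTheory.tendsto_integral_mul_prod {μ : Measure X} {ν : Measure Y}
    [IsFiniteMeasure μ] [IsFiniteMeasure ν]
    {a : ℕ → X → ℝ} {a' : X → ℝ} {b : ℕ → Y → ℝ} {b' : Y → ℝ} {A B : NNReal}
    (ham : ∀ n, Measurable (a n)) (ham' : Measurable a')
    (haA : ∀ n x, ‖a n x‖ ≤ A) (haA' : ∀ x, ‖a' x‖ ≤ A)
    (hbm : ∀ n, Measurable (b n)) (hbm' : Measurable b')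
    (hbB : ∀ n y, ‖b n y‖ ≤ B) (hbB' : ∀ y, ‖b' y‖ ≤ B)
    (ha : ∀ g : X → ℝ, Integrable g μ →
      Tendsto (fun n => ∫ x, g x * a n x ∂μ) atTop (𝓝 (∫ x, g x * a' x ∂μ)))
    (hb : ∀ g : Y → ℝ, Integrable g ν →
      Tendsto (fun n => ∫ y, g y * b n y ∂ν) atTop (𝓝 (∫ y, g y * b' y ∂ν)))
    {G : X × Y → ℝ} (hG : Integrable G (μ.prod ν)) :
    Tendsto (fun n => ∫ p, G p * (a n p.1 * b n p.2) ∂(μ.prod ν)) atTop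
      (𝓝 (∫ p, G p * (a' p.1 * b' p.2) ∂(μ.prod ν))) := by
  refine tendsto_integral_mul_of_piSystem (C := A * B) generateFrom_prod.symm isPiSystem_prod
    ⟨Set.univ, .univ, Set.univ, .univ, Set.univ_prod_univ⟩
    (fun n => ((ham n).comp measurable_fst).mul ((hbm n).comp measurable_snd))
    ((ham'.comp measurable_fst).mul (hbm'.comp measurable_snd)) (fun n p => ?_) (fun p => ?_)
    ?_ hG
  · refine (norm_mul _ _).trans_le ?_
    rw [NNReal.coe_mul]
    exact mul_le_mul (haA n _) (hbB n _) (norm_nonneg _) A.2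
  · refine (norm_mul _ _).trans_le ?_
    rw [NNReal.coe_mul]
    exact mul_le_mul (haA' _) (hbB' _) (norm_nonneg _) A.2
  · rintro _ ⟨s, hs, t, ht, rfl⟩
    have hprod (f : X → ℝ) (g : Y → ℝ) :
        ∫ p in s ×ˢ t, ((f ∘ Prod.fst) * (g ∘ Prod.snd) : X × Y → ℝ) p ∂μ.prod ν =
          (∫ x in s, f x ∂μ) * ∫ y in t, g y ∂ν :=
      setIntegral_prod_mul f g s t
    simp_rw [hprod]
    have has := ha (s.indicator fun _ => 1) ((integrable_const 1).indicator hs)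
    have hbt := hb (t.indicator fun _ => 1) ((integrable_const 1).indicator ht)
    simp_rw [integral_indicator_const_mul hs, one_mul] at has
    simp_rw [integral_indicator_const_mul ht, one_mul] at hbt
    exact has.mul hbt

end WeakStar

section YoungMeasure

variable {Ω E : Type*} [MeasurableSpace Ω] [TopologicalSpace E]

/-- The embedding of `E × E` in the square of the one-point compactification of `E`. -/
def OnePoint.pairEmbedding (E : Type*) : E × E → OnePoint E × OnePoint E :=
  Prod.map (↑) (↑)

theorem OnePoint.isOpenEmbedding_pairEmbedding :
    IsOpenEmbedding (OnePoint.pairEmbedding E) :=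
  isOpenEmbedding_coe.prodMap isOpenEmbedding_coe

theorem OnePoint.measurable_comp_pairEmbedding [SecondCountableTopology E]
    [MeasurableSpace E] [BorelSpace E] (H : C(OnePoint E × OnePoint E, ℝ)) :
    Measurable fun z => H (pairEmbedding E z) :=
  (H.continuous.comp isOpenEmbedding_pairEmbedding.continuous).measurable

theorem OnePoint.integrable_comp_pairEmbedding [SecondCountableTopology E]
    [MeasurableSpace E] [BorelSpace E] (ρ : Measure (E × E)) [IsFiniteMeasure ρ]
    (H : C(OnePoint E × OnePoint E, ℝ)) : Integrable (fun z => H (pairEmbedding E z)) ρ :=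
  .of_bound (measurable_comp_pairEmbedding H).aestronglyMeasurable ‖H‖
    (ae_of_all _ fun _ => H.norm_coe_le_norm _)

theorem OnePoint.lipschitzWith_integral_comp_pairEmbedding [SecondCountableTopology E]
    [MeasurableSpace E] [BorelSpace E] (ρ : Measure (E × E))
    [IsProbabilityMeasure ρ] :
    LipschitzWith 1 fun H : C(OnePoint E × OnePoint E, ℝ) => ∫ z, H (pairEmbedding E z) ∂ρ := by
  refine LipschitzWith.of_dist_le_mul fun H₁ H₂ => ?_
  rw [dist_eq_norm, dist_eq_norm, ← integral_sub (integrable_comp_pairEmbedding ρ _)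
    (integrable_comp_pairEmbedding ρ _)]
  refine (norm_integral_le_of_norm_le_const (ae_of_all _ fun z =>
    (H₁ - H₂).norm_coe_le_norm (pairEmbedding E z))).trans ?_
  simp

variable [T2Space E] [MeasurableSpace E] [BorelSpace E]

theorem MeasureTheory.integral_onePoint_eq (ρ : Measure E) [IsProbabilityMeasure ρ]
    (f : C(OnePoint E, ℝ)) :
    ∫ z, f z ∂ρ = f OnePoint.infty + ∫ z, OnePoint.toZeroAtInfty f z ∂ρ := by
  have hint : Integrable (fun z : E => f z) ρ :=
    .of_bound (f.continuous.comp OnePoint.continuous_coe).measurable.aestronglyMeasurable ‖f‖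
      (ae_of_all _ fun _ => f.norm_coe_le_norm _)
  have h : ∫ z, OnePoint.toZeroAtInfty f z ∂ρ = ∫ z : E, (f z - f OnePoint.infty) ∂ρ := rfl
  rw [h, integral_sub hint (integrable_const _)]
  simp

variable {ν : Ω → Measure E} [∀ x, IsProbabilityMeasure (ν x)]

theorem MeasureTheory.measurable_integral_onePoint
    (hν : ∀ f : ZeroAtInftyContinuousMap E ℝ, Measurable fun x => ∫ z, f z ∂(ν x))
    (f : C(OnePoint E, ℝ)) : Measurable fun x => ∫ z : E, f z ∂(ν x) := by
  simp_rw [integral_onePoint_eq _ f]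
  exact (hν _).const_add _

variable {μ : Measure Ω} {u : ℕ → Ω → E}

theorem MeasureTheory.tendsto_integral_mul_onePoint (hu : ∀ n, Measurable (u n))
    (hν : ∀ f : ZeroAtInftyContinuousMap E ℝ, Measurable fun x => ∫ z, f z ∂(ν x))
    (hgen : ∀ f : ZeroAtInftyContinuousMap E ℝ, ∀ g : Ω → ℝ, Integrable g μ →
      Tendsto (fun n => ∫ x, g x * f (u n x) ∂μ) atTop (𝓝 (∫ x, g x * ∫ z, f z ∂(ν x) ∂μ)))
    (f : C(OnePoint E, ℝ)) {g : Ω → ℝ} (hg : Integrable g μ) :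
    Tendsto (fun n => ∫ x, g x * f (u n x) ∂μ) atTop
      (𝓝 (∫ x, g x * ∫ z : E, f z ∂(ν x) ∂μ)) := by
  set f₀ := OnePoint.toZeroAtInfty f with hf₀
  have hf (z : E) : f z = f OnePoint.infty + f₀ z := (add_sub_cancel _ _).symm
  have hbound (z : E) : ‖f₀ z‖ ≤ ‖f₀.toBCF‖ := f₀.toBCF.norm_coe_le_norm z
  have hint (n : ℕ) : Integrable (fun x => g x * f₀ (u n x)) μ :=
    hg.mul_bdd (f₀.continuous.measurable.comp (hu n)).aestronglyMeasurable
      (ae_of_all _ fun x => hbound _)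
  have hint' : Integrable (fun x => g x * ∫ z, f₀ z ∂(ν x)) μ :=
    hg.mul_bdd (c := ‖f₀.toBCF‖) (hν f₀).aestronglyMeasurable (ae_of_all _ fun x => by
      simpa using norm_integral_le_of_norm_le_const (μ := ν x) (ae_of_all _ hbound))
  simp_rw [integral_onePoint_eq _ f, hf, ← hf₀, mul_add,
    integral_add (hg.mul_const _) (hint _), integral_add (hg.mul_const _) hint']
  exact (hgen f₀ g hg).const_add _

variable [SecondCountableTopology E] [LocallyCompactSpace E]

theorem MeasureTheory.measurable_integral_pairEmbedding
    (hν : ∀ f : ZeroAtInftyContinuousMap E ℝ, Measurable fun x => ∫ z, f z ∂(ν x))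
    (H : C(OnePoint E × OnePoint E, ℝ)) :
    Measurable fun p : Ω × Ω => ∫ z, H (OnePoint.pairEmbedding E z) ∂((ν p.1).prod (ν p.2)) := by
  induction H using ContinuousMap.prod_induction with
  | mul f g =>
    have key (p : Ω × Ω) : ∫ z, (f.comp .fst * g.comp .snd : C(OnePoint E × OnePoint E, ℝ))
        (OnePoint.pairEmbedding E z)
        ∂((ν p.1).prod (ν p.2)) = (∫ z : E, f z ∂(ν p.1)) * ∫ z : E, g z ∂(ν p.2) :=
      integral_prod_mul (fun z : E => f z) fun z : E => g z
    simp_rw [key]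
    exact ((measurable_integral_onePoint hν f).comp measurable_fst).mul
      ((measurable_integral_onePoint hν g).comp measurable_snd)
  | add H₁ H₂ h₁ h₂ =>
    simp_rw [ContinuousMap.add_apply, integral_add (OnePoint.integrable_comp_pairEmbedding _ H₁)
      (OnePoint.integrable_comp_pairEmbedding _ H₂)]
    exact h₁.add h₂
  | smul c H h =>
    simp_rw [ContinuousMap.smul_apply, smul_eq_mul, integral_const_mul]
    exact h.const_mul c
  | closed =>
    refine IsSeqClosed.isClosed fun H H' hH hlim => ?_
    refine measurable_of_tendsto_metrizable hH (tendsto_pi_nhds.2 fun p => ?_)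
    exact ((OnePoint.lipschitzWith_integral_comp_pairEmbedding
      ((ν p.1).prod (ν p.2))).continuous.tendsto H').comp hlim

theorem MeasureTheory.tendsto_integral_mul_pairEmbedding [IsFiniteMeasure μ] (hu : ∀ n, Measurable (u n))
    (hν : ∀ f : ZeroAtInftyContinuousMap E ℝ, Measurable fun x => ∫ z, f z ∂(ν x))
    (hgen : ∀ f : ZeroAtInftyContinuousMap E ℝ, ∀ g : Ω → ℝ, Integrable g μ →
      Tendsto (fun n => ∫ x, g x * f (u n x) ∂μ) atTop (𝓝 (∫ x, g x * ∫ z, f z ∂(ν x) ∂μ)))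
    {G : Ω × Ω → ℝ} (hG : Integrable G (μ.prod μ)) (H : C(OnePoint E × OnePoint E, ℝ)) :
    Tendsto (fun n => ∫ p, G p * H (OnePoint.pairEmbedding E (u n p.1, u n p.2)) ∂(μ.prod μ)) atTop
      (𝓝 (∫ p, G p * ∫ z, H (OnePoint.pairEmbedding E z) ∂((ν p.1).prod (ν p.2)) ∂(μ.prod μ))) := by
  have hm (n : ℕ) (H : C(OnePoint E × OnePoint E, ℝ)) :
      Measurable fun p : Ω × Ω => H (OnePoint.pairEmbedding E (u n p.1, u n p.2)) :=
    (OnePoint.measurable_comp_pairEmbedding H).comp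
      (((hu n).comp measurable_fst).prodMk ((hu n).comp measurable_snd))
  have hm' (H : C(OnePoint E × OnePoint E, ℝ)) := measurable_integral_pairEmbedding hν H
  have hb (H : C(OnePoint E × OnePoint E, ℝ)) (p : Ω × Ω) :
      ‖∫ z, H (OnePoint.pairEmbedding E z) ∂((ν p.1).prod (ν p.2))‖ ≤ ‖H‖ := by
    simpa using norm_integral_le_of_norm_le_const (μ := (ν p.1).prod (ν p.2))
      (ae_of_all _ fun z => H.norm_coe_le_norm (OnePoint.pairEmbedding E z))
  have hint (n : ℕ) (H : C(OnePoint E × OnePoint E, ℝ)) :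
      Integrable (fun p => G p * H (OnePoint.pairEmbedding E (u n p.1, u n p.2))) (μ.prod μ) :=
    hG.mul_bdd (hm n H).aestronglyMeasurable (ae_of_all _ fun _ => H.norm_coe_le_norm _)
  have hint' (H : C(OnePoint E × OnePoint E, ℝ)) : Integrable (fun p => G p *
      ∫ z, H (OnePoint.pairEmbedding E z) ∂((ν p.1).prod (ν p.2))) (μ.prod μ) :=
    hG.mul_bdd (hm' H).aestronglyMeasurable (ae_of_all _ (hb H))
  induction H using ContinuousMap.prod_induction with
  | mul f g =>
    have key (p : Ω × Ω) : ∫ z, (f.comp .fst * g.comp .snd : C(OnePoint E × OnePoint E, ℝ))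
        (OnePoint.pairEmbedding E z)
        ∂((ν p.1).prod (ν p.2)) = (∫ z : E, f z ∂(ν p.1)) * ∫ z : E, g z ∂(ν p.2) :=
      integral_prod_mul (fun z : E => f z) fun z : E => g z
    have hfm (f : C(OnePoint E, ℝ)) (n : ℕ) : Measurable fun x => f (u n x) :=
      (f.continuous.comp OnePoint.continuous_coe).measurable.comp (hu n)
    have hfb (f : C(OnePoint E, ℝ)) (x : Ω) : ‖∫ z : E, f z ∂(ν x)‖ ≤ ‖f‖₊ := by
      simpa using norm_integral_le_of_norm_le_const (μ := ν x)
        (ae_of_all _ fun z : E => f.norm_coe_le_norm z)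
    simp_rw [key]
    exact tendsto_integral_mul_prod (hfm f) (measurable_integral_onePoint hν f)
      (fun n x => f.norm_coe_le_norm _) (hfb f) (hfm g) (measurable_integral_onePoint hν g)
      (fun n x => g.norm_coe_le_norm _) (hfb g)
      (fun _ hk => tendsto_integral_mul_onePoint hu hν hgen f hk)
      (fun _ hk => tendsto_integral_mul_onePoint hu hν hgen g hk) hG
  | add H₁ H₂ h₁ h₂ =>
    simp_rw [ContinuousMap.add_apply, integral_add (OnePoint.integrable_comp_pairEmbedding _ H₁)
      (OnePoint.integrable_comp_pairEmbedding _ H₂), mul_add, integral_add (hint _ H₁) (hint _ H₂),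
      integral_add (hint' H₁) (hint' H₂)]
    exact h₁.add h₂
  | smul c H h =>
    simp_rw [ContinuousMap.smul_apply, smul_eq_mul, integral_const_mul, mul_left_comm _ c,
      integral_const_mul]
    exact h.const_mul c
  | closed =>
    refine Equicontinuous.isClosed_setOfPred_tendsto
      (F := fun n (H : C(OnePoint E × OnePoint E, ℝ)) =>
        ∫ p, G p * H (OnePoint.pairEmbedding E (u n p.1, u n p.2)) ∂(μ.prod μ))
      (LipschitzWith.uniformEquicontinuous _ (∫ p, ‖G p‖ ∂(μ.prod μ)).toNNReal fun n =>
        lipschitzWith_integral_mul_of_forall hG (hm n) (fun H p => H.norm_coe_le_norm _)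
          fun p => ?_).equicontinuous
      (lipschitzWith_integral_mul_of_forall hG hm' hb fun p =>
        OnePoint.lipschitzWith_integral_comp_pairEmbedding _).continuous
    exact LipschitzWith.of_dist_le_mul fun H₁ H₂ => by
      simpa using ContinuousMap.dist_apply_le_dist _

end YoungMeasure

/-- Tensorization of Young measures. If a sequence `u_n : Ω → ℝ^k` generates the
Young measure `ν` (duality with `C₀(ℝ^k)` against `L¹(Ω)` weights), then the paired sequence
`(x,y) ↦ (u_n(x), u_n(y))` generates the binary tensor Young measure `ν²_{x,y} = ν_x ⊗ ν_y`. -/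
theorem young_measure_tensorization
    {Ω : Type*} [MeasurableSpace Ω] (μ : Measure Ω) [IsFiniteMeasure μ] (k : ℕ)
    (u : ℕ → Ω → EuclideanSpace ℝ (Fin k)) (hu : ∀ n, Measurable (u n))
    (ν : Ω → Measure (EuclideanSpace ℝ (Fin k)))
    (hνprob : ∀ x, IsProbabilityMeasure (ν x))
    (hνmeas : ∀ f : ZeroAtInftyContinuousMap (EuclideanSpace ℝ (Fin k)) ℝ,
      Measurable fun x => ∫ z, f z ∂(ν x))
    (hgen : ∀ f : ZeroAtInftyContinuousMap (EuclideanSpace ℝ (Fin k)) ℝ,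
      ∀ g : Ω → ℝ, Integrable g μ →
        Tendsto (fun n => ∫ x, g x * f (u n x) ∂μ) atTop
          (𝓝 (∫ x, g x * ∫ z, f z ∂(ν x) ∂μ))) :
    ∀ F : ZeroAtInftyContinuousMap
        (EuclideanSpace ℝ (Fin k) × EuclideanSpace ℝ (Fin k)) ℝ,
      ∀ G : Ω × Ω → ℝ, Integrable G (μ.prod μ) →
        Tendsto (fun n => ∫ p, G p * F (u n p.1, u n p.2) ∂(μ.prod μ)) atTop
          (𝓝 (∫ p, G p * ∫ z, F z ∂((ν p.1).prod (ν p.2)) ∂(μ.prod μ))) := by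
  intro F G hG
  let H : C(OnePoint (EuclideanSpace ℝ (Fin k)) × OnePoint (EuclideanSpace ℝ (Fin k)), ℝ) :=
    ⟨_, OnePoint.isOpenEmbedding_pairEmbedding.continuous_extend_zero F⟩
  have hH (z : EuclideanSpace ℝ (Fin k) × EuclideanSpace ℝ (Fin k)) :
      H (OnePoint.pairEmbedding _ z) = F z :=
    OnePoint.isOpenEmbedding_pairEmbedding.injective.extend_apply _ _ z
  simpa only [hH] using tendsto_integral_mul_pairEmbedding hu hνmeas hgen hG H
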